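/- arXiv:2005.02685 — 3 statements merged into one kernel-verified Lean document; each statement's English description precedes it below -/
import Mathlib

section
/- For every integer n ≥ 1, ∑_{k=1}^∞ ((ζ(2k) − 1)/n^{2k−1})·L_{2k−1} = π·sin(π/n)/(cos(π/n) − cos(√5·π/n)) − 2n(n⁴ − n² + 3)/((2n² − 3 + √5)(2n² − 3 − √5)). -/
open Real

def lucas : ℕ → ℕ
  | 0 => 2
  | 1 => 1
  | n + 2 => lucas n + lucas (n + 1)

def fibZ (n : ℤ) : ℤ :=
  if 0 ≤ n then (Nat.fib n.toNat : ℤ) else (-1) ^ (n.natAbs + 1) * (Nat.fib n.natAbs : ℤ)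

def lucasZ (n : ℤ) : ℤ :=
  if 0 ≤ n then (lucas n.toNat : ℤ) else (-1) ^ n.natAbs * (lucas n.natAbs : ℤ)

theorem norm_natCast_add_two (m : ℕ) : ‖(m : ℂ) + 2‖ = (m : ℝ) + 2 := by
  exact_mod_cast Complex.norm_natCast (m + 2)

theorem hasSum_one_div_add_two_pow {k : ℕ} (hk : 1 < k) :
    HasSum (fun m : ℕ ↦ 1 / ((m : ℂ) + 2) ^ k) (riemannZeta k - 1) := by
  have hs : Summable (fun m : ℕ ↦ 1 / (m : ℂ) ^ k) := by
    have h := (Complex.summable_one_div_nat_cpow (p := (k : ℂ))).2 (by simpa using hk)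
    simpa using h
  have h := (hasSum_nat_add_iff' 2).2 hs.hasSum
  rw [← zeta_nat_eq_tsum_of_gt_one hk] at h
  have hk0 : k ≠ 0 := by omega
  simpa [Finset.sum_range_succ, hk0] using h

theorem summable_pow_div_add_two_pow {x : ℂ} (hx : ‖x‖ < 2) :
    Summable (fun p : ℕ × ℕ ↦ x ^ (2 * p.1 + 1) / ((p.2 : ℂ) + 2) ^ (2 * p.1 + 2)) := by
  have hgeom : Summable (fun k : ℕ ↦ ‖x‖ * (‖x‖ ^ 2 / 4) ^ k) :=
    (summable_geometric_of_lt_one (by positivity)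
      (by nlinarith [norm_nonneg x])).mul_left _
  have hsq : Summable (fun m : ℕ ↦ 1 / ((m : ℝ) + 2) ^ 2) := by
    have h := (summable_nat_add_iff 2).2 (Real.summable_one_div_nat_pow.2 (one_lt_two))
    simpa using h
  refine Summable.of_norm_bounded
    (hgeom.mul_of_nonneg hsq (fun k ↦ by positivity) (fun m ↦ by positivity)) ?_
  rintro ⟨k, m⟩
  have hm : ‖(m : ℂ) + 2‖ = (m : ℝ) + 2 := norm_natCast_add_two m
  have h4 : (4 : ℝ) ^ k ≤ ((m : ℝ) + 2) ^ (2 * k) := by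
    rw [pow_mul]
    gcongr
    nlinarith [(Nat.cast_nonneg m : (0 : ℝ) ≤ m)]
  simp only [norm_div, norm_pow, hm]
  rw [div_pow, mul_one_div, mul_div_assoc', div_div, ← pow_mul, pow_add _ (2 * k) 2,
    pow_succ' ‖x‖]
  gcongr

theorem hasSum_zeta_sub_one_mul_pow {x : ℂ} (hx : ‖x‖ < 2) :
    HasSum (fun k : ℕ ↦ (riemannZeta (2 * (k + 1)) - 1) * x ^ (2 * k + 1))
      (∑' m : ℕ, x / (((m : ℂ) + 2) ^ 2 - x ^ 2)) := by
  have hs := summable_pow_div_add_two_pow hx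
  have hrow (m : ℕ) : HasSum (fun k : ℕ ↦ x ^ (2 * k + 1) / ((m : ℂ) + 2) ^ (2 * k + 2))
      (x / (((m : ℂ) + 2) ^ 2 - x ^ 2)) := by
    have hm : ‖(m : ℂ) + 2‖ = (m : ℝ) + 2 := norm_natCast_add_two m
    have hlt : ‖x‖ < ‖(m : ℂ) + 2‖ := by
      rw [hm]; linarith [(Nat.cast_nonneg m : (0 : ℝ) ≤ m)]
    have hm0 : (m : ℂ) + 2 ≠ 0 := norm_pos_iff.1 ((norm_nonneg x).trans_lt hlt)
    have hr : ‖x ^ 2 / ((m : ℂ) + 2) ^ 2‖ < 1 := by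
      rw [norm_div, norm_pow, norm_pow, div_lt_one (by rw [hm]; positivity)]
      gcongr
    have hd : ((m : ℂ) + 2) ^ 2 - x ^ 2 ≠ 0 := by
      intro h
      have h' := congrArg norm (sub_eq_zero.1 h)
      rw [norm_pow, norm_pow] at h'
      nlinarith [norm_nonneg x]
    have h := (hasSum_geometric_of_norm_lt_one hr).mul_left (x / ((m : ℂ) + 2) ^ 2)
    convert! h using 1
    · funext k
      rw [div_pow, ← pow_mul, ← pow_mul]
      field_simp
      ring
    · have : 1 - x ^ 2 / ((m : ℂ) + 2) ^ 2 ≠ 0 := by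
        rw [one_sub_div (pow_ne_zero 2 hm0)]
        exact div_ne_zero hd (pow_ne_zero 2 hm0)
      field_simp
  have hcol (k : ℕ) : HasSum (fun m : ℕ ↦ x ^ (2 * k + 1) / ((m : ℂ) + 2) ^ (2 * k + 2))
      ((riemannZeta (2 * (k + 1)) - 1) * x ^ (2 * k + 1)) := by
    have h := (hasSum_one_div_add_two_pow (k := 2 * k + 2) (by omega)).mul_right (x ^ (2 * k + 1))
    convert! h using 2
    · ring
    · push_cast; ring_nf
  have h := hs.hasSum.prod_fiberwise hcol
  have h' := ((Equiv.prodComm ℕ ℕ).hasSum_iff.2 hs.hasSum).prod_fiberwise hrow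
  rwa [h'.tsum_eq]

theorem tsum_div_add_two_sq_sub_sq {x : ℂ} (hx : x ∈ Complex.integerComplement) :
    ∑' m : ℕ, x / (((m : ℂ) + 2) ^ 2 - x ^ 2) =
      (1 / x - π * Complex.cot (π * x)) / 2 - x / (1 - x ^ 2) := by
  have hs := summable_cotTerm hx
  have h := hs.hasSum
  simp only [cotTerm] at h
  rw [← cot_series_rep' hx] at h
  have h2 := ((hasSum_nat_add_iff' 1).2 h).mul_left (-1 / 2)
  have hne (j : ℤ) : x - j ≠ 0 := by
    simpa [sub_eq_add_neg] using Complex.integerComplement_add_ne_zero hx (-j)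
  have hone : 1 - x ^ 2 ≠ 0 := by
    have h1 := hne 1
    have h3 := hne (-1)
    push_cast at h1 h3
    intro h0
    exact mul_ne_zero h1 h3 (by linear_combination -h0)
  have hf : (fun m : ℕ ↦ x / (((m : ℂ) + 2) ^ 2 - x ^ 2)) = fun m : ℕ ↦
      -1 / 2 * (1 / (x - (((m + 1 : ℕ) : ℂ) + 1)) + 1 / (x + (((m + 1 : ℕ) : ℂ) + 1))) := by
    funext m
    have h1 := hne (m + 2)
    have h3 := hne (-(m + 2))
    push_cast at h1 h3 ⊢
    have e1 : x - ((m : ℂ) + 1 + 1) ≠ 0 := by convert h1 using 1; ring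
    have e2 : x + ((m : ℂ) + 1 + 1) ≠ 0 := by convert h3 using 1; ring
    have e3 : ((m : ℂ) + 2) ^ 2 - x ^ 2 ≠ 0 := by
      intro h0
      exact mul_ne_zero h1 h3 (by linear_combination -h0)
    field_simp
    ring
  rw [hf, h2.tsum_eq]
  have h1 := hne 1
  have h3 := hne (-1)
  push_cast at h1 h3
  rw [sub_neg_eq_add] at h3
  have hx0 := Complex.integerComplement.ne_zero hx
  simp only [Finset.range_one, Finset.sum_singleton, Nat.cast_zero, zero_add]
  field_simp
  ring

theorem lucas_eq_goldenRatio_pow_add (k : ℕ) :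
    (lucas k : ℝ) = goldenRatio ^ k + goldenConj ^ k := by
  induction k using lucas.induct with
  | case1 => norm_num [lucas]
  | case2 => simp [lucas, goldenRatio_add_goldenConj]
  | case3 k h1 h2 =>
    rw [lucas]
    push_cast
    rw [h1, h2, pow_add _ k 2, pow_add _ k 2, goldenRatio_sq, goldenConj_sq]
    ring

theorem Irrational.ofReal_mem_integerComplement {x : ℝ} (hx : Irrational x) :
    (x : ℂ) ∈ Complex.integerComplement := by
  rintro ⟨j, hj⟩
  exact hx.ne_int j (by exact_mod_cast hj.symm)

theorem Irrational.sin_pi_mul_ne_zero {x : ℝ} (hx : Irrational x) : Real.sin (π * x) ≠ 0 := by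
  rw [Ne, Real.sin_eq_zero_iff]
  rintro ⟨j, hj⟩
  exact hx.ne_int j (mul_left_cancel₀ Real.pi_ne_zero (by linarith))

theorem hasSum_zeta_sub_one_mul_pow_of_irrational {x : ℝ} (hx : Irrational x) (hx2 : |x| < 2) :
    HasSum (fun k : ℕ ↦ (riemannZeta (2 * (k + 1)) - 1) * (x : ℂ) ^ (2 * k + 1))
      (((1 / x - π * Real.cot (π * x)) / 2 - x / (1 - x ^ 2) : ℝ) : ℂ) := by
  have h := hasSum_zeta_sub_one_mul_pow (x := (x : ℂ)) (by simpa using hx2)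
  rw [tsum_div_add_two_sq_sub_sq hx.ofReal_mem_integerComplement] at h
  push_cast
  exact h

theorem stmt6 (n : ℕ) (hn : 1 ≤ n) :
    ∑' k : ℕ, (riemannZeta (2 * (k + 1)) - 1) / (n : ℂ) ^ (2 * k + 1) * (lucas (2 * k + 1) : ℂ) =
      ((π * Real.sin (π / n) / (Real.cos (π / n) - Real.cos (Real.sqrt 5 * π / n))
        - 2 * n * ((n : ℝ) ^ 4 - (n : ℝ) ^ 2 + 3) /
          ((2 * (n : ℝ) ^ 2 - 3 + Real.sqrt 5) * (2 * (n : ℝ) ^ 2 - 3 - Real.sqrt 5)) : ℝ) : ℂ) := by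
  have hn1 : (1 : ℝ) ≤ n := by exact_mod_cast hn
  have hn0 : (n : ℝ) ≠ 0 := by positivity
  have hirr {y : ℝ} (hy : Irrational y) : Irrational (y / n) := hy.div_natCast (by omega)
  have habs {y : ℝ} (hy : |y| < 2) : |y / n| < 2 := by
    rw [abs_div, Nat.abs_cast]
    exact (div_le_self (abs_nonneg y) hn1).trans_lt hy
  have ha := hirr goldenRatio_irrational
  have hb := hirr goldenConj_irrational
  have hA := hasSum_zeta_sub_one_mul_pow_of_irrational ha
    (habs (by rw [abs_of_pos goldenRatio_pos]; exact goldenRatio_lt_two))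
  have hB := hasSum_zeta_sub_one_mul_pow_of_irrational hb
    (habs (by rw [abs_of_neg goldenConj_neg]; linarith [neg_one_lt_goldenConj]))
  have hterm : (fun k : ℕ ↦ (riemannZeta (2 * (k + 1)) - 1) / (n : ℂ) ^ (2 * k + 1) *
      (lucas (2 * k + 1) : ℂ)) = fun k : ℕ ↦
      (riemannZeta (2 * (k + 1)) - 1) * ((goldenRatio / n : ℝ) : ℂ) ^ (2 * k + 1) +
      (riemannZeta (2 * (k + 1)) - 1) * ((goldenConj / n : ℝ) : ℂ) ^ (2 * k + 1) := by
    funext k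
    have hl : (lucas (2 * k + 1) : ℂ) =
        (goldenRatio : ℂ) ^ (2 * k + 1) + (goldenConj : ℂ) ^ (2 * k + 1) := by
      exact_mod_cast congrArg ((↑) : ℝ → ℂ) (lucas_eq_goldenRatio_pow_add (2 * k + 1))
    rw [hl, Complex.ofReal_div goldenRatio, Complex.ofReal_div goldenConj, Complex.ofReal_natCast, div_pow, div_pow]
    ring
  rw [hterm, (hA.add hB).tsum_eq, ← Complex.ofReal_add]
  congr 1
  have hsa := ha.sin_pi_mul_ne_zero
  have hsb := hb.sin_pi_mul_ne_zero
  have hadd : π / n = π * (goldenRatio / n) + π * (goldenConj / n) := by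
    rw [← mul_add, ← add_div, goldenRatio_add_goldenConj, mul_one_div]
  have hsub : √5 * π / n = π * (goldenRatio / n) - π * (goldenConj / n) := by
    rw [← mul_sub, ← sub_div, goldenRatio_sub_goldenConj]
    ring
  have hcot : π * Real.sin (π / n) / (Real.cos (π / n) - Real.cos (√5 * π / n)) =
      -(π * Real.cot (π * (goldenRatio / n)) + π * Real.cot (π * (goldenConj / n))) / 2 := by
    rw [hadd, hsub, Real.sin_add, Real.cos_add, Real.cos_sub, Real.cot_eq_cos_div_sin,
      Real.cot_eq_cos_div_sin]
    generalize Real.sin (π * (goldenRatio / n)) = s at *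
    generalize Real.sin (π * (goldenConj / n)) = t at *
    rw [show ∀ c d : ℝ, c * d - s * t - (c * d + s * t) = -2 * (s * t) by intros; ring]
    field_simp
    ring
  rw [hcot]
  have h5 : (2 * (n : ℝ) ^ 2 - 3 + √5) * (2 * (n : ℝ) ^ 2 - 3 - √5) =
      4 * ((n : ℝ) ^ 4 - 3 * (n : ℝ) ^ 2 + 1) := by
    linear_combination -Real.sq_sqrt (show (0 : ℝ) ≤ 5 by norm_num)
  have hrat {y : ℝ} (hy : Irrational y) : (n : ℝ) ^ 2 - y ^ 2 ≠ 0 := by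
    intro h
    rcases sq_eq_sq_iff_eq_or_eq_neg.1 (sub_eq_zero.1 h) with h | h
    · exact hy.ne_nat n h.symm
    · exact hy.ne_int (-n) (by push_cast; linarith)
  have hda := hrat goldenRatio_irrational
  have hdb := hrat goldenConj_irrational
  have hinv : 1 / (goldenRatio / n) + 1 / (goldenConj / n) = -(n : ℝ) := by
    rw [one_div_div, one_div_div, div_add_div _ _ goldenRatio_ne_zero goldenConj_ne_zero,
      goldenRatio_mul_goldenConj]
    linear_combination -(n : ℝ) * goldenRatio_add_goldenConj
  have hP : ((n : ℝ) ^ 2 - goldenRatio ^ 2) * ((n : ℝ) ^ 2 - goldenConj ^ 2) =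
      (n : ℝ) ^ 4 - 3 * (n : ℝ) ^ 2 + 1 := by
    linear_combination (-(n : ℝ) ^ 2) * (goldenRatio_sq + goldenConj_sq + goldenRatio_add_goldenConj)
      + (goldenRatio * goldenConj - 1) * goldenRatio_mul_goldenConj
  have hN : (n : ℝ) ^ 4 - 3 * (n : ℝ) ^ 2 + 1 ≠ 0 := hP ▸ mul_ne_zero hda hdb
  have hfrac (y : ℝ) : y / n / (1 - (y / n) ^ 2) = n * y / ((n : ℝ) ^ 2 - y ^ 2) := by
    rw [div_pow, one_sub_div (pow_ne_zero 2 hn0)]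
    field_simp
  have hsum : goldenRatio / n / (1 - (goldenRatio / n) ^ 2) +
      goldenConj / n / (1 - (goldenConj / n) ^ 2) =
      n * ((n : ℝ) ^ 2 + 1) / ((n : ℝ) ^ 4 - 3 * (n : ℝ) ^ 2 + 1) := by
    rw [hfrac, hfrac, div_add_div _ _ hda hdb, hP]
    congr 1
    linear_combination ((n : ℝ) ^ 3 - n * goldenRatio * goldenConj) * goldenRatio_add_goldenConj
      - n * goldenRatio_mul_goldenConj
  have hfin : 2 * n * ((n : ℝ) ^ 4 - (n : ℝ) ^ 2 + 3) /
      (4 * ((n : ℝ) ^ 4 - 3 * (n : ℝ) ^ 2 + 1)) =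
      n / 2 + n * ((n : ℝ) ^ 2 + 1) / ((n : ℝ) ^ 4 - 3 * (n : ℝ) ^ 2 + 1) := by
    rw [div_add_div _ _ two_ne_zero hN,
      div_eq_div_iff (mul_ne_zero four_ne_zero hN) (mul_ne_zero two_ne_zero hN)]
    ring
  rw [h5, hfin, ← hsum]
  linear_combination (1 / 2 : ℝ) * hinv
end

section
/- For every integer m ≥ 0, ∑_{k=1}^∞ (ζ(2k+1) − 1)·L_{2k+m} = (L_m + L_{m+2})/2 − L_m·(π/√5)·tan(√5·π/2) − (L_m/2)·∑_{n=1}^∞ 1/(n(n+1)(n² + 3n + 1)). -/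
open Real

open Filter Topology
open scoped goldenRatio

theorem lucas_eq_goldenRatio_pow_add_s8 (n : ℕ) : (lucas n : ℝ) = φ ^ n + ψ ^ n := by
  induction n using Nat.twoStepInduction with
  | zero => norm_num [lucas]
  | one => simp [lucas, Real.goldenRatio_add_goldenConj]
  | more n h₀ h₁ =>
    rw [lucas, Nat.cast_add, h₀, h₁, pow_add φ n 2, pow_add ψ n 2, Real.goldenRatio_sq,
      Real.goldenConj_sq]
    ring

theorem Antitone.hasSum_sub_succ {f : ℕ → ℝ} (hf : Antitone f) (h0 : Tendsto f atTop (𝓝 0)) :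
    HasSum (fun n ↦ f n - f (n + 1)) (f 0) := by
  rw [hasSum_iff_tendsto_nat_of_nonneg fun n ↦ sub_nonneg.2 (hf n.le_succ)]
  simp_rw [Finset.sum_range_sub']
  simpa using h0.const_sub (f 0)

theorem tendsto_inv_natCast_add (c : ℝ) : Tendsto (fun n : ℕ ↦ 1 / ((n : ℝ) + c)) atTop (𝓝 0) := by
  simp_rw [one_div]
  exact (tendsto_atTop_add_const_right _ c tendsto_natCast_atTop_atTop).inv_tendsto_atTop

theorem goldenRatio_mem_integerComplement : (φ : ℂ) ∈ Complex.integerComplement := by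
  rintro ⟨n, hn⟩
  exact Real.goldenRatio_irrational ⟨n, by exact_mod_cast hn⟩

theorem cot_pi_mul_goldenRatio : Real.cot (π * φ) = -Real.tan (√5 * π / 2) := by
  have : π * φ = √5 * π / 2 + π / 2 := by rw [Real.goldenRatio]; ring
  rw [this, Real.cot_eq_cos_div_sin, Real.tan_eq_sin_div_cos, Real.cos_add_pi_div_two,
    Real.sin_add_pi_div_two, neg_div]

theorem hasSum_cotTerm_goldenRatio :
    HasSum (fun n : ℕ ↦ 1 / (φ - (n + 1)) + 1 / (φ + (n + 1)))
      (-π * Real.tan (√5 * π / 2) - 1 / φ) := by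
  have h := (summable_cotTerm goldenRatio_mem_integerComplement).hasSum
  rw [← cot_series_rep' goldenRatio_mem_integerComplement] at h
  rw [neg_mul, ← mul_neg, ← cot_pi_mul_goldenRatio]
  generalize φ = a at h ⊢
  refine Complex.hasSum_ofReal.1 ?_
  push_cast
  exact h

theorem hasSum_one_div_sq_add_sub_one :
    HasSum (fun n : ℕ ↦ 1 / ((n + 1 : ℝ) ^ 2 + (n + 1) - 1))
      (1 + π / √5 * Real.tan (√5 * π / 2)) := by
  have h5 : √5 ^ 2 = 5 := Real.sq_sqrt (by norm_num)
  have h5' : √5 ≠ 0 := by positivity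
  have hφ : φ ^ 2 = φ + 1 := Real.goldenRatio_sq
  have hφ5 : √5 = 2 * φ - 1 := by rw [Real.goldenRatio]; ring
  have h1 := Real.one_lt_goldenRatio
  have h2 := Real.goldenRatio_lt_two
  have hc := (hasSum_nat_add_iff' 1).2 hasSum_cotTerm_goldenRatio
  have ht : HasSum (fun n : ℕ ↦ 1 / ((n : ℝ) + (φ + 1)) - 1 / (((n + 1 : ℕ) : ℝ) + (φ + 1)))
      (1 / (((0 : ℕ) : ℝ) + (φ + 1))) := by
    refine Antitone.hasSum_sub_succ (f := fun n : ℕ ↦ 1 / ((n : ℝ) + (φ + 1)))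
      (fun a b hab ↦ ?_) (tendsto_inv_natCast_add _)
    dsimp only
    gcongr
  convert! ((hc.add ht).neg.div_const √5) using 1
  · ext n
    have hn : (0 : ℝ) ≤ n := n.cast_nonneg
    have e1 : φ - (n + 1 + 1) ≠ 0 := by linarith
    have e2 : φ + (n + 1 + 1) ≠ 0 := by positivity
    have e3 : (n : ℝ) + (φ + 1) ≠ 0 := by positivity
    have e4 : (n : ℝ) + 1 + (φ + 1) ≠ 0 := by positivity
    have e5 : (n + 1 : ℝ) ^ 2 + (n + 1) - 1 = ((n : ℝ) + (φ + 1)) * (-(φ - (n + 1 + 1))) := by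
      linear_combination hφ
    rw [e5]
    push_cast
    clear hc ht
    generalize φ = a at *
    have e6 : -(a - (n + 1 + 1)) ≠ 0 := neg_ne_zero.2 e1
    generalize hq : a - (n + 1 + 1) = q at *
    field_simp
    rw [hφ5, ← hq]
    ring
  · have e1 : φ - 1 ≠ 0 := by linarith
    have e2 : φ ≠ 0 := by positivity
    have e4 : 1 / φ + 1 / (φ - 1) = √5 := by
      clear hc ht
      generalize φ = a at *
      rw [hφ5]
      field_simp
      linear_combination (1 - 2 * a) * hφ
    clear hc ht
    generalize φ = a at *
    simp only [Finset.sum_range_one, Nat.cast_zero, zero_add]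
    rw [show 1 / (a - 1) = √5 - 1 / a by linarith]
    field_simp
    ring

theorem sq_sub_goldenRatio_sq_mul_sq_sub_goldenConj_sq (x : ℝ) :
    (x ^ 2 - φ ^ 2) * (x ^ 2 - ψ ^ 2) = (x ^ 2 - x - 1) * (x ^ 2 + x - 1) := by
  have h : (φ * ψ) ^ 2 = 1 := by rw [Real.goldenRatio_mul_goldenConj]; norm_num
  linear_combination h - x ^ 2 * (Real.goldenRatio_sq + Real.goldenConj_sq +
    Real.goldenRatio_add_goldenConj)

theorem hasSum_div_sq_sub_mul :
    HasSum (fun n : ℕ ↦ (n + 2 : ℝ) /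
      (((n + 2 : ℝ) ^ 2 - (n + 2) - 1) * ((n + 2 : ℝ) ^ 2 + (n + 2) - 1))) (1 / 2) := by
  have hs := hasSum_one_div_sq_add_sub_one.summable.tendsto_atTop_zero
  have ht :=
    (Antitone.hasSum_sub_succ (fun a b hab ↦ by gcongr; nlinarith) hs).div_const 2
  convert! ht using 1
  · ext n
    have hn : (0 : ℝ) ≤ n := n.cast_nonneg
    have e1 : (n + 1 : ℝ) ^ 2 + (n + 1) - 1 ≠ 0 := by nlinarith
    have e2 : (n + 1 + 1 : ℝ) ^ 2 + (n + 1 + 1) - 1 ≠ 0 := by nlinarith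
    rw [show (n + 2 : ℝ) ^ 2 - (n + 2) - 1 = (n + 1 : ℝ) ^ 2 + (n + 1) - 1 by ring,
      show (n + 2 : ℝ) ^ 2 + (n + 2) - 1 = (n + 1 + 1 : ℝ) ^ 2 + (n + 1 + 1) - 1 by ring]
    push_cast
    generalize hp : (n + 1 : ℝ) ^ 2 + (n + 1) - 1 = p at *
    generalize hq : (n + 1 + 1 : ℝ) ^ 2 + (n + 1 + 1) - 1 = q at *
    field_simp
    rw [← hp, ← hq]
    ring
  · norm_num

theorem summable_one_div_mul_succ_mul :
    Summable fun n : ℕ ↦ 1 / ((n + 1 : ℝ) * ((n + 1 : ℝ) + 1) *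
      ((n + 1 : ℝ) ^ 2 + 3 * (n + 1 : ℝ) + 1)) := by
  refine Summable.of_nonneg_of_le (fun n ↦ by positivity) (fun n ↦ ?_)
    hasSum_one_div_sq_add_sub_one.summable
  have hn : (0 : ℝ) ≤ n := n.cast_nonneg
  apply one_div_le_one_div_of_le
  · nlinarith
  · nlinarith [mul_nonneg hn hn, mul_nonneg (mul_nonneg hn hn) hn,
      mul_nonneg (mul_nonneg hn hn) (mul_nonneg hn hn)]

theorem hasSum_one_div_mul_sq_sub_mul :
    HasSum (fun n : ℕ ↦ 1 / ((n + 2 : ℝ) *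
        (((n + 2 : ℝ) ^ 2 - (n + 2) - 1) * ((n + 2 : ℝ) ^ 2 + (n + 2) - 1))))
      ((∑' n : ℕ, 1 / ((n + 1 : ℝ) * ((n + 1 : ℝ) + 1) *
        ((n + 1 : ℝ) ^ 2 + 3 * (n + 1 : ℝ) + 1))) / 2 - 1 / 2 +
        π / √5 * Real.tan (√5 * π / 2)) := by
  have hp := hasSum_one_div_sq_add_sub_one
  have hq : Tendsto (fun n : ℕ ↦ (n + 2 : ℝ) / ((n + 1 : ℝ) ^ 2 + (n + 1) - 1)) atTop (𝓝 0) := by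
    refine squeeze_zero (fun n ↦ ?_) (fun n ↦ ?_)
      (by simpa using (tendsto_inv_natCast_add 1).const_mul 2)
    · have hn : (0 : ℝ) ≤ n := n.cast_nonneg
      exact div_nonneg (by positivity) (by nlinarith)
    · have hn : (0 : ℝ) ≤ n := n.cast_nonneg
      rw [← div_eq_mul_inv, div_le_div_iff₀ (by nlinarith) (by positivity)]
      nlinarith
  have hf := (tendsto_inv_natCast_add 1).add hq
  rw [add_zero] at hf
  have ht := (Antitone.hasSum_sub_succ (fun a b hab ↦ by
    have ha : (0 : ℝ) ≤ a := a.cast_nonneg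
    have hab' : (a : ℝ) ≤ b := Nat.cast_le.2 hab
    gcongr ?_ + ?_
    · gcongr
    · rw [div_le_div_iff₀ (by nlinarith) (by nlinarith)]
      nlinarith [mul_nonneg ha (sub_nonneg.2 hab'), mul_nonneg (ha.trans hab') (sub_nonneg.2 hab'),
        mul_nonneg (mul_nonneg ha (ha.trans hab')) (sub_nonneg.2 hab')]) hf).div_const 2
  convert! ((summable_one_div_mul_succ_mul.hasSum.div_const 2).add hp).sub ht using 1
  · ext n
    have hn : (0 : ℝ) ≤ n := n.cast_nonneg
    have e1 : (n + 1 : ℝ) ^ 2 + (n + 1) - 1 ≠ 0 := by nlinarith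
    have e2 : (n + 1 + 1 : ℝ) ^ 2 + (n + 1 + 1) - 1 ≠ 0 := by nlinarith
    rw [show (n + 2 : ℝ) ^ 2 - (n + 2) - 1 = (n + 1 : ℝ) ^ 2 + (n + 1) - 1 by ring,
      show (n + 2 : ℝ) ^ 2 + (n + 2) - 1 = (n + 1 + 1 : ℝ) ^ 2 + (n + 1 + 1) - 1 by ring,
      show (n + 1 : ℝ) ^ 2 + 3 * (n + 1) + 1 = (n + 1 + 1 : ℝ) ^ 2 + (n + 1 + 1) - 1 by ring]
    push_cast
    have e3 : (n : ℝ) + 1 ≠ 0 := by positivity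
    have e4 : (n : ℝ) + 2 ≠ 0 := by positivity
    have e5 : (n : ℝ) + 1 + 1 ≠ 0 := by positivity
    clear hp ht hf hq
    generalize hp : (n + 1 : ℝ) ^ 2 + (n + 1) - 1 = p at *
    generalize hq : (n + 1 + 1 : ℝ) ^ 2 + (n + 1 + 1) - 1 = q at *
    field_simp
    rw [← hp, ← hq]
    ring
  · norm_num
    ring

/-- The geometric series behind `∑ L_{2k+m+2} / x ^ (2k+3)`. -/
theorem hasSum_lucas_div_pow (m : ℕ) {x : ℝ} (hx : 2 ≤ x) :
    HasSum (fun k : ℕ ↦ (lucas (2 * k + m + 2) : ℝ) / x ^ (2 * k + 3))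
      ((lucas (m + 2) : ℝ) * (x / ((x ^ 2 - x - 1) * (x ^ 2 + x - 1))) -
        (lucas m : ℝ) * (1 / (x * ((x ^ 2 - x - 1) * (x ^ 2 + x - 1))))) := by
  have h1 := Real.one_lt_goldenRatio
  have h2 := Real.goldenRatio_lt_two
  have h3 := Real.goldenConj_neg
  have h4 := Real.neg_one_lt_goldenConj
  have hx0 : x ≠ 0 := by positivity
  have hφ : 0 < x ^ 2 - φ ^ 2 := by nlinarith
  have hψ : 0 < x ^ 2 - ψ ^ 2 := by nlinarith
  have hgeom (r : ℝ) (hr : 0 < x ^ 2 - r ^ 2) :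
      HasSum (fun k : ℕ ↦ r ^ (2 * k + m + 2) / x ^ (2 * k + 3))
        (r ^ (m + 2) / (x * (x ^ 2 - r ^ 2))) := by
    have := (hasSum_geometric_of_lt_one (r := r ^ 2 / x ^ 2) (by positivity)
      ((div_lt_one (by positivity)).2 (by linarith))).mul_left (r ^ (m + 2) / x ^ 3)
    convert! this using 1
    · ext k
      rw [div_pow, ← pow_mul, ← pow_mul]
      field_simp
      ring
    · field_simp
  have h : (φ * ψ) ^ 2 = 1 := by rw [Real.goldenRatio_mul_goldenConj]; norm_num
  have hadd := (hgeom φ hφ).add (hgeom ψ hψ)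
  simp only [← add_div, ← lucas_eq_goldenRatio_pow_add_s8] at hadd
  convert! hadd using 1
  rw [lucas_eq_goldenRatio_pow_add_s8, lucas_eq_goldenRatio_pow_add_s8,
    ← sq_sub_goldenRatio_sq_mul_sq_sub_goldenConj_sq]
  clear hgeom hadd
  generalize φ = a at *
  generalize ψ = b at *
  have ha := hφ.ne'
  have hb := hψ.ne'
  field_simp
  linear_combination (a ^ m + b ^ m) * h

theorem riemannZeta_odd_sub_one (k : ℕ) :
    riemannZeta (2 * (k + 1) + 1) - 1 = ((∑' n : ℕ, 1 / (n + 2 : ℝ) ^ (2 * k + 3) : ℝ) : ℂ) := by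
  have hs : Summable fun n : ℕ ↦ 1 / (n : ℂ) ^ (2 * k + 3) := by
    simpa using (Complex.summable_ofReal.2
      (Real.summable_one_div_nat_pow.2 (show 1 < 2 * k + 3 by lia)))
  have := zeta_nat_eq_tsum_of_gt_one (show 1 < 2 * k + 3 by lia)
  rw [← hs.sum_add_tsum_nat_add 2] at this
  rw [show (2 * (k + 1) + 1 : ℂ) = ((2 * k + 3 : ℕ) : ℂ) by push_cast; ring, this]
  rw [Complex.ofReal_tsum]
  simp [Finset.sum_range_succ]

theorem summable_one_div_add_two_pow (k : ℕ) :
    Summable fun n : ℕ ↦ 1 / (n + 2 : ℝ) ^ (2 * k + 3) := by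
  simpa using (summable_nat_add_iff 2).2
    (Real.summable_one_div_nat_pow.2 (show 1 < 2 * k + 3 by lia))

theorem tsum_odd_zeta_mul_lucas (m : ℕ) :
    ∑' k : ℕ, (∑' n : ℕ, 1 / (n + 2 : ℝ) ^ (2 * k + 3)) * (lucas (2 * k + m + 2) : ℝ) =
      ((lucas m : ℝ) + (lucas (m + 2) : ℝ)) / 2
        - (lucas m : ℝ) * (π / √5) * Real.tan (√5 * π / 2)
        - (lucas m : ℝ) / 2 *
          ∑' n : ℕ, 1 / ((n + 1 : ℝ) * ((n + 1 : ℝ) + 1) *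
            ((n + 1 : ℝ) ^ 2 + 3 * (n + 1 : ℝ) + 1)) := by
  have hrow (n : ℕ) := hasSum_lucas_div_pow m (x := n + 2) (by linarith [n.cast_nonneg (α := ℝ)])
  have hsum := (hasSum_div_sq_sub_mul.mul_left (lucas (m + 2) : ℝ)).sub
    (hasSum_one_div_mul_sq_sub_mul.mul_left (lucas m : ℝ))
  have hs : Summable fun p : ℕ × ℕ ↦
      (lucas (2 * p.2 + m + 2) : ℝ) / (p.1 + 2 : ℝ) ^ (2 * p.2 + 3) :=
    (summable_prod_of_nonneg fun p ↦ by dsimp only [Pi.zero_apply]; positivity).2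
      ⟨fun n ↦ (hrow n).summable, by simpa only [(hrow _).tsum_eq] using hsum.summable⟩
  have hcomm := hs.tsum_comm
    (f := fun n k : ℕ ↦ (lucas (2 * k + m + 2) : ℝ) / (n + 2 : ℝ) ^ (2 * k + 3))
  simp only [(hrow _).tsum_eq, hsum.tsum_eq] at hcomm
  simp_rw [← tsum_mul_right, one_div_mul_eq_div, hcomm]
  ring

theorem stmt8 (m : ℕ) :
    ∑' k : ℕ, (riemannZeta (2 * (k + 1) + 1) - 1) * (lucas (2 * k + m + 2) : ℂ) =
      ((((lucas m : ℝ) + (lucas (m + 2) : ℝ)) / 2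
        - (lucas m : ℝ) * (π / Real.sqrt 5) * Real.tan (Real.sqrt 5 * π / 2)
        - (lucas m : ℝ) / 2 *
          ∑' n : ℕ, 1 / ((n + 1 : ℝ) * ((n + 1 : ℝ) + 1) *
            ((n + 1 : ℝ) ^ 2 + 3 * (n + 1 : ℝ) + 1)) : ℝ) : ℂ) := by
  rw [← tsum_odd_zeta_mul_lucas, Complex.ofReal_tsum]
  simp_rw [riemannZeta_odd_sub_one, Complex.ofReal_mul, Complex.ofReal_natCast]
end

section
/- For every integer m ≥ 0, ∑_{k=1}^∞ (ζ(2k+1) − 1)·F_{2k+m}/(2k+1) = (1 − γ)·F_m + (L_{m−1}/(2√5))·(ln(−π·sec(√5·π/2)) − 2·ln Γ(α) − 4·ln α), where α = (1+√5)/2, γ is the Euler–Mascheroni constant, Γ is the gamma function, and for m = 0 one sets L_{−1} = −1 (the standard extension to negative indices). -/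
open Real

section

open Filter Topology Finset

theorem tendsto_harmonic_add_two_sub_log :
    Tendsto (fun n : ℕ ↦ (harmonic (n + 2) : ℝ) - log n) atTop (𝓝 eulerMascheroniConstant) := by
  have h1 : Tendsto (fun n : ℕ ↦ 1 / ((n : ℝ) + 1)) atTop (𝓝 0) :=
    tendsto_one_div_add_atTop_nhds_zero_nat
  have h2 := h1.comp (tendsto_add_atTop_nat 1)
  convert (tendsto_harmonic_sub_log.add h1).add h2 using 2 with n
  · rw [harmonic_succ, harmonic_succ]
    simp only [Function.comp_apply]
    push_cast
    ring
  · ring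

theorem sum_inv_add_two (n : ℕ) :
    ∑ j ∈ range (n + 1), ((j : ℝ) + 2)⁻¹ = harmonic (n + 2) - 1 := by
  induction n with
  | zero => norm_num [harmonic_succ]
  | succ n ih =>
    rw [sum_range_succ, ih, harmonic_succ (n + 2)]
    push_cast
    ring

theorem tendsto_sum_log_sub_log {x : ℝ} (hx : |x| < 2) :
    Tendsto (fun n : ℕ ↦ ∑ j ∈ range n,
        ((log (j + 2 + x) - log (j + 2 - x)) / 2 - x / (j + 2))) atTop
      (𝓝 ((log (Gamma (2 - x)) - log (Gamma (2 + x))) / 2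
        + (1 - eulerMascheroniConstant) * x)) := by
  obtain ⟨hx1, hx2⟩ := abs_lt.mp hx
  rw [← tendsto_add_atTop_iff_nat 1]
  have ha := BohrMollerup.tendsto_log_gamma (x := 2 - x) (by linarith)
  have hb := BohrMollerup.tendsto_log_gamma (x := 2 + x) (by linarith)
  have hc := (tendsto_harmonic_add_two_sub_log.const_sub 1).mul_const x
  refine (((ha.sub hb).div_const 2).add hc).congr fun n ↦ ?_
  have h1 : ∑ j ∈ range (n + 1), log (2 - x + j) = ∑ j ∈ range (n + 1), log (j + 2 - x) :=
    sum_congr rfl fun j _ ↦ by ring_nf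
  have h2 : ∑ j ∈ range (n + 1), log (2 + x + j) = ∑ j ∈ range (n + 1), log (j + 2 + x) :=
    sum_congr rfl fun j _ ↦ by ring_nf
  simp only [BohrMollerup.logGammaSeq, h1, h2, sum_sub_distrib, ← sum_div, div_eq_mul_inv x,
    ← mul_sum, sum_inv_add_two]
  ring

theorem hasSum_odd_pow_div {x y : ℝ} (hy : 0 < y) (hxy : |x| < y) :
    HasSum (fun k : ℕ ↦ (x / y) ^ (2 * k + 3) / (2 * k + 3))
      ((log (y + x) - log (y - x)) / 2 - x / y) := by
  obtain ⟨hx1, hx2⟩ := abs_lt.mp hxy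
  have hlt : |x / y| < 1 := by rwa [abs_div, abs_of_pos hy, div_lt_one hy]
  have h := (hasSum_log_sub_log_of_abs_lt_one hlt).div_const 2
  rw [← hasSum_nat_add_iff' 1] at h
  have h1 : 1 + x / y = (y + x) / y := by field_simp
  have h2 : 1 - x / y = (y - x) / y := by field_simp
  rw [h1, h2, log_div (by linarith) hy.ne', log_div (by linarith) hy.ne'] at h
  have hv : (log (y + x) - log (y - x)) / 2 - x / y =
      (log (y + x) - log y - (log (y - x) - log y)) / 2 -
        ∑ i ∈ range 1, 2 * (1 / (2 * (i : ℝ) + 1)) * (x / y) ^ (2 * i + 1) / 2 := by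
    simp
  rw [hv]
  refine h.congr_fun fun k ↦ ?_
  push_cast
  rw [show 2 * (k + 1) + 1 = 2 * k + 3 by ring,
    show 2 * ((k : ℝ) + 1) + 1 = 2 * k + 3 by ring]
  ring

theorem summable_inv_add_two_pow {p : ℕ} (hp : 1 < p) :
    Summable (fun n : ℕ ↦ (((n : ℝ) + 2) ^ p)⁻¹) := by
  have h := (summable_nat_add_iff 2).mpr (Real.summable_nat_pow_inv.mpr hp)
  simpa using h

theorem riemannZeta_sub_one_eq_tsum {p : ℕ} (hp : 1 < p) :
    riemannZeta p - 1 = ((∑' n : ℕ, (((n : ℝ) + 2) ^ p)⁻¹ : ℝ) : ℂ) := by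
  have hs := Real.summable_nat_pow_inv.mpr hp
  have h := hs.sum_add_tsum_nat_add 2
  have hz : riemannZeta p = ((∑' n : ℕ, ((n : ℝ) ^ p)⁻¹ : ℝ) : ℂ) := by
    rw [zeta_nat_eq_tsum_of_gt_one hp]
    push_cast
    simp
  rw [hz, ← h]
  simp [sum_range_succ, show p ≠ 0 by omega]

theorem summable_div_add_two_odd_pow {x : ℝ} (hx : |x| < 2) :
    Summable (fun q : ℕ × ℕ ↦ (x / ((q.1 : ℝ) + 2)) ^ (2 * q.2 + 3) / (2 * (q.2 : ℝ) + 3)) := by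
  have h1 := (summable_inv_add_two_pow (p := 3) (by norm_num)).mul_left (|x| ^ 3)
  have h2 : Summable fun k : ℕ ↦ ((|x| / 2) ^ 2) ^ k :=
    summable_geometric_of_lt_one (by positivity)
      (pow_lt_one₀ (by positivity) (by linarith) two_ne_zero)
  refine (h1.mul_of_nonneg h2 (fun n ↦ by positivity) fun k ↦ by positivity).of_norm_bounded ?_
  rintro ⟨n, k⟩
  have hn : (0 : ℝ) ≤ n := n.cast_nonneg
  have hk : (0 : ℝ) ≤ k := k.cast_nonneg
  rw [norm_div, norm_pow, norm_div, Real.norm_of_nonneg (by positivity : 0 ≤ (n : ℝ) + 2),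
    Real.norm_of_nonneg (by positivity : 0 ≤ 2 * (k : ℝ) + 3), norm_eq_abs]
  refine (div_le_self (by positivity) (by linarith)).trans ?_
  rw [pow_add, mul_comm, div_pow _ _ 3, ← div_eq_mul_inv, ← pow_mul]
  gcongr
  linarith

theorem hasSum_zeta_sub_one_mul_pow_div {x : ℝ} (hx : |x| < 2) :
    HasSum (fun k : ℕ ↦ (∑' n : ℕ, (((n : ℝ) + 2) ^ (2 * k + 3))⁻¹) * x ^ (2 * k + 3)
        / (2 * k + 3))
      ((log (Gamma (2 - x)) - log (Gamma (2 + x))) / 2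
        + (1 - eulerMascheroniConstant) * x) := by
  have hs := (summable_div_add_two_odd_pow hx).hasSum
  have hn := hs.prod_fiberwise fun n ↦ hasSum_odd_pow_div (x := x) (y := (n : ℝ) + 2)
    (by positivity) (by have : (0 : ℝ) ≤ n := n.cast_nonneg
                        linarith)
  rw [tendsto_nhds_unique hn.tendsto_sum_nat (tendsto_sum_log_sub_log hx)] at hs
  refine ((Equiv.prodComm ℕ ℕ).hasSum_iff.mpr hs).prod_fiberwise fun k ↦ ?_
  refine (((summable_inv_add_two_pow (p := 2 * k + 3) (by omega)).hasSum.mul_right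
    (x ^ (2 * k + 3))).div_const (2 * k + 3)).congr_fun fun n ↦ ?_
  simp only [Function.comp_apply, Equiv.prodComm_apply, Prod.fst_swap, Prod.snd_swap, div_pow]
  ring

theorem coe_lucas_eq (n : ℕ) : (lucas n : ℝ) = goldenRatio ^ n + goldenConj ^ n := by
  induction n using Nat.twoStepInduction with
  | zero => norm_num [lucas]
  | one => simp [lucas]
  | more n h1 h2 =>
    rw [lucas, Nat.cast_add, h1, h2, pow_add _ n 2, pow_add _ n 2, goldenRatio_sq, goldenConj_sq]
    ring

theorem coe_lucasZ_sub_one (m : ℕ) :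
    (lucasZ ((m : ℤ) - 1) : ℝ) =
      -(goldenRatio ^ m * goldenConj) - goldenConj ^ m * goldenRatio := by
  cases m with
  | zero =>
    have := goldenRatio_add_goldenConj
    simp [lucasZ, lucas]
    linarith
  | succ n =>
    have := goldenRatio_mul_goldenConj
    have h : (lucasZ (((n + 1 : ℕ) : ℤ) - 1) : ℝ) = lucas n := by simp [lucasZ]
    rw [h, coe_lucas_eq]
    linear_combination (goldenRatio ^ n + goldenConj ^ n) * this

theorem Gamma_two_add_goldenRatio :
    Gamma (2 + goldenRatio) = goldenRatio ^ 3 * Gamma goldenRatio := by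
  have h := goldenRatio_pos
  rw [show 2 + goldenRatio = goldenRatio + 1 + 1 by ring, Gamma_add_one (by positivity),
    Gamma_add_one h.ne', ← goldenRatio_sq]
  ring

theorem Gamma_two_sub_goldenRatio_mul :
    Gamma (2 - goldenRatio) * Gamma goldenRatio * goldenRatio = -π / cos (√5 * π / 2) := by
  have h := one_lt_goldenRatio
  have hsin : sin (π * goldenRatio) = cos (√5 * π / 2) := by
    rw [← sin_add_pi_div_two, goldenRatio]
    ring_nf
  have hrefl := Gamma_mul_Gamma_one_sub goldenRatio
  rw [hsin] at hrefl
  rw [show 2 - goldenRatio = 1 - goldenRatio + 1 by ring, Gamma_add_one (by linarith), neg_div,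
    ← hrefl]
  linear_combination (-(Gamma goldenRatio * Gamma (1 - goldenRatio))) * goldenRatio_sq

theorem log_Gamma_two_sub_goldenRatio :
    log (Gamma (2 - goldenRatio)) - log (Gamma (2 + goldenRatio)) =
      log (-π / cos (√5 * π / 2)) - 2 * log (Gamma goldenRatio) - 4 * log goldenRatio := by
  have h := goldenRatio_pos
  have h1 := (Gamma_pos_of_pos h).ne'
  have h2 := (Gamma_pos_of_pos (sub_pos.mpr goldenRatio_lt_two)).ne'
  rw [← Gamma_two_sub_goldenRatio_mul, Gamma_two_add_goldenRatio, log_mul (by positivity) h1,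
    log_mul (mul_ne_zero h2 h1) h.ne', log_mul h2 h1, log_pow]
  push_cast
  ring

theorem log_Gamma_two_sub_goldenConj :
    log (Gamma (2 - goldenConj)) - log (Gamma (2 + goldenConj)) =
      -(log (Gamma (2 - goldenRatio)) - log (Gamma (2 + goldenRatio))) := by
  have h := goldenRatio_pos
  have h2 := sub_pos.mpr goldenRatio_lt_two
  have h3 := Gamma_pos_of_pos h2
  have h4 := Gamma_pos_of_pos (by linarith : 0 < goldenRatio + 1)
  have ha : 2 - goldenConj = goldenRatio + 1 := by linarith [goldenRatio_add_goldenConj]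
  have hb : 2 + goldenConj = 2 - goldenRatio + 1 := by linarith [goldenRatio_add_goldenConj]
  have hc : 2 + goldenRatio = goldenRatio + 1 + 1 := by ring
  have hprod : log (2 - goldenRatio) + log (goldenRatio + 1) = 0 := by
    rw [← log_mul h2.ne' (by positivity), show (2 - goldenRatio) * (goldenRatio + 1) = 1 by
      linear_combination -goldenRatio_sq, log_one]
  rw [ha, hb, hc, Gamma_add_one h2.ne', Gamma_add_one (by positivity : goldenRatio + 1 ≠ 0),
    log_mul h2.ne' h3.ne', log_mul (by positivity) h4.ne']
  linarith

theorem hasSum_zeta_sub_one_mul_fib_div (m : ℕ) :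
    HasSum (fun k : ℕ ↦ (∑' n : ℕ, (((n : ℝ) + 2) ^ (2 * k + 3))⁻¹) * Nat.fib (2 * k + m + 2)
        / (2 * k + 3))
      ((1 - eulerMascheroniConstant) * (Nat.fib m : ℝ) + (lucasZ ((m : ℤ) - 1) : ℝ) / (2 * √5) *
        (log (-π / cos (√5 * π / 2)) - 2 * log (Gamma goldenRatio) - 4 * log goldenRatio)) := by
  have hmul := goldenRatio_mul_goldenConj
  have h1 := hasSum_zeta_sub_one_mul_pow_div (x := goldenRatio)
    (abs_lt.mpr ⟨by linarith [goldenRatio_pos], goldenRatio_lt_two⟩)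
  have h2 := hasSum_zeta_sub_one_mul_pow_div (x := goldenConj)
    (abs_lt.mpr ⟨by linarith [neg_one_lt_goldenConj], by linarith [goldenConj_neg]⟩)
  rw [log_Gamma_two_sub_goldenConj] at h2
  rw [← log_Gamma_two_sub_goldenRatio]
  have h := ((h1.mul_left (-(goldenRatio ^ m * goldenConj))).add
    (h2.mul_left (goldenConj ^ m * goldenRatio))).div_const √5
  refine HasSum.congr_fun (Eq.subst (motive := HasSum _) ?_ h) fun k ↦ ?_
  · rw [coe_fib_eq, coe_lucasZ_sub_one]
    generalize goldenRatio = a at hmul ⊢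
    generalize goldenConj = b at hmul ⊢
    linear_combination -((1 - eulerMascheroniConstant) * (a ^ m - b ^ m) / √5) * hmul
  · rw [coe_fib_eq]
    generalize goldenRatio = a at hmul ⊢
    generalize goldenConj = b at hmul ⊢
    generalize (∑' n : ℕ, (((n : ℝ) + 2) ^ (2 * k + 3))⁻¹) = z
    linear_combination
      z * (a ^ (2 * k + m + 2) - b ^ (2 * k + m + 2)) / √5 / (2 * k + 3) * hmul

end

theorem stmt16 (m : ℕ) :
    ∑' k : ℕ, (riemannZeta (2 * (k + 1) + 1) - 1) * (Nat.fib (2 * k + m + 2) : ℂ) /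
        (2 * (k + 1) + 1 : ℂ) =
      (((1 - Real.eulerMascheroniConstant) * (Nat.fib m : ℝ)
        + (lucasZ ((m : ℤ) - 1) : ℝ) / (2 * Real.sqrt 5) *
          (Real.log (-π / Real.cos (Real.sqrt 5 * π / 2))
            - 2 * Real.log (Real.Gamma ((1 + Real.sqrt 5) / 2))
            - 4 * Real.log ((1 + Real.sqrt 5) / 2)) : ℝ) : ℂ) := by
  rw [← (Complex.hasSum_ofReal.mpr (hasSum_zeta_sub_one_mul_fib_div m)).tsum_eq]
  refine tsum_congr fun k ↦ ?_
  have h := riemannZeta_sub_one_eq_tsum (p := 2 * k + 3) (by omega)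
  have hk : (2 * (k + 1) + 1 : ℂ) = (2 * k + 3 : ℕ) := by
    push_cast
    ring
  rw [hk, h]
  push_cast
  rfl
end
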